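/- arXiv:1502.07118 — 3 statements merged into one kernel-verified Lean document; each statement's English description precedes it below -/
import Mathlib

section
/- The stack sequential specification S_S is closed under data-projection: for every sequence s ∈ S_S and every subset V' ⊆ V, the subsequence of s consisting of the method calls push(x) and pop(x) with x ∈ V' ∪ Emp belongs to S_S. -/
namespace LL

universe u v w

/-- Method calls of a container alphabet: insertions `ins x` of a value `x ∈ V`,
and removals `rem v` of a value `v ∈ V` or returning an "empty" value in `E`. -/
inductive CMethod (V : Type u) (E : Type v) where
  | ins : V → CMethod V E
  | rem : V ⊕ E → CMethod V E

/-- Events of a concurrent history: invocations and responses of method calls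
in `σ`, tagged with a thread identifier in `I`. -/
inductive Event (σ : Type u) (I : Type v) where
  | inv : σ → I → Event σ I
  | res : σ → I → Event σ I

variable {σ : Type*} {I : Type*} {V : Type*} {E : Type*} {α : Type*}

/-- The method call of an event. -/
def Event.method : Event σ I → σ
  | .inv m _ => m
  | .res m _ => m

/-- The thread identifier of an event. -/
def Event.thread : Event σ I → I
  | .inv _ k => k
  | .res _ k => k

/-- Whether an event is an invocation. -/
def Event.isInv : Event σ I → Bool
  | .inv _ _ => true
  | .res _ _ => false

/-- `a` occurs (strictly) before `b` in the sequence `s`. -/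
def OccursBefore (s : List α) (a b : α) : Prop :=
  ∃ i j : Fin s.length, i < j ∧ s.get i = a ∧ s.get j = b

/-- A set of sequences is prefix-closed. -/
def PrefixClosed (S : Set (List α)) : Prop :=
  ∀ s ∈ S, ∀ t : List α, t <+: s → t ∈ S

open Classical in
/-- The subsequence of events of thread `k`. -/
noncomputable def threadEvents (h : List (Event σ I)) (k : I) : List (Event σ I) :=
  h.filter fun e => decide (e.thread = k)

/-- `h` is a well-formed concurrent history: no event occurs twice, each method
call is invoked at most once, every response is preceded by its matching
invocation, and in every thread's subsequence of events each invocation is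
immediately followed by its matching response. -/
structure IsHistory (h : List (Event σ I)) : Prop where
  nodup : h.Nodup
  invUnique : ∀ (i j : Fin h.length) (m : σ) (k k' : I),
      h.get i = Event.inv m k → h.get j = Event.inv m k' → i = j
  resMatched : ∀ (j : Fin h.length) (m : σ) (k : I), h.get j = Event.res m k →
      ∃ i : Fin h.length, i < j ∧ h.get i = Event.inv m k
  threadSeq : ∀ (k : I) (i : ℕ) (m : σ),
      (threadEvents h k)[i]? = some (Event.inv m k) →
      ∀ e : Event σ I, (threadEvents h k)[i + 1]? = some e → e = Event.res m k

/-- The method call `m` appears in `h` (its invocation occurs in `h`). -/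
def Appears (h : List (Event σ I)) (m : σ) : Prop :=
  ∃ k : I, Event.inv m k ∈ h

/-- `h` is complete: every invocation has its matching response in `h`. -/
def HistComplete (h : List (Event σ I)) : Prop :=
  ∀ (m : σ) (k : I), Event.inv m k ∈ h → Event.res m k ∈ h

/-- The method call `m` (executed by thread `k`) is pending in `h`. -/
def PendingCall (h : List (Event σ I)) (m : σ) (k : I) : Prop :=
  Event.inv m k ∈ h ∧ Event.res m k ∉ h

/-- `hc` is a completion of `h`: a complete well-formed history obtained from `h`
by deleting some pending invocations and appending matching responses for the
remaining pending invocations. -/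
def IsCompletionOf (hc h : List (Event σ I)) : Prop :=
  IsHistory hc ∧ HistComplete hc ∧
  ∃ h' r : List (Event σ I),
    h'.Sublist h ∧
    (∀ e ∈ h, e ∉ h' → ∃ (m : σ) (k : I), e = Event.inv m k ∧ PendingCall h m k) ∧
    (∀ e ∈ r, ∃ (m : σ) (k : I), e = Event.res m k ∧ PendingCall h m k) ∧
    hc = h' ++ r

/-- The precedence order of `h`: `m <_h n` iff the response of `m` occurs in `h`
before the invocation of `n`. -/
def Precedes (h : List (Event σ I)) (m n : σ) : Prop :=
  ∃ (i j : Fin h.length) (k k' : I),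
    i < j ∧ h.get i = Event.res m k ∧ h.get j = Event.inv n k'

/-- The sequence of method calls of a history (in invocation order). -/
def methodList (h : List (Event σ I)) : List σ :=
  (h.filter Event.isInv).map Event.method

/-- `h` is linearizable wrt the sequential specification `S`. -/
def Linearizable (S : Set (List σ)) (h : List (Event σ I)) : Prop :=
  ∃ hc : List (Event σ I), IsCompletionOf hc h ∧
    ∃ s ∈ S, s.Perm (methodList hc) ∧
      ∀ m n : σ, Precedes hc m n → OccursBefore s m n

/-- `h` is sequentially consistent wrt `S`. -/
def SeqConsistent (S : Set (List σ)) (h : List (Event σ I)) : Prop :=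
  ∃ hc : List (Event σ I), IsCompletionOf hc h ∧
    ∃ s ∈ S, s.Perm (methodList hc) ∧
      ∀ m n : σ, Precedes hc m n →
        (∃ k : I, Event.inv m k ∈ hc ∧ Event.inv n k ∈ hc) →
        OccursBefore s m n

/-- Position `p` is a quiescent state of `h`: every invocation occurring before
position `p` has its matching response before position `p`. -/
def QuiescentAt (h : List (Event σ I)) (p : ℕ) : Prop :=
  ∀ (i : Fin h.length) (m : σ) (k : I), (i : ℕ) < p → h.get i = Event.inv m k →
    ∃ j : Fin h.length, (j : ℕ) < p ∧ h.get j = Event.res m k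

/-- `h` is quiescently consistent wrt `S`. -/
def QuiescentConsistent (S : Set (List σ)) (h : List (Event σ I)) : Prop :=
  ∃ hc : List (Event σ I), IsCompletionOf hc h ∧
    ∃ s ∈ S, s.Perm (methodList hc) ∧
      ∀ m n : σ,
        (∃ p : ℕ, QuiescentAt hc p ∧
          (∃ (i : Fin hc.length) (k : I), (i : ℕ) < p ∧ hc.get i = Event.res m k) ∧
          (∃ (j : Fin hc.length) (k : I), p ≤ (j : ℕ) ∧ hc.get j = Event.inv n k)) →
        OccursBefore s m n

/-- Membership of a method call in `I_T ∪ O_T`: insertions performed by thread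
`T` in `h`, removals of values inserted by `T` in `h`, and removals returning an
"empty" value. -/
def InducedMethod (h : List (Event (CMethod V E) I)) (T : I) : CMethod V E → Prop
  | .ins x => Event.inv (CMethod.ins x) T ∈ h
  | .rem (Sum.inl x) => Event.inv (CMethod.ins x) T ∈ h
  | .rem (Sum.inr _) => True

open Classical in
/-- The thread-induced history `h_T`: the subsequence of `h` of events of method
calls in `I_T ∪ O_T`. -/
noncomputable def threadInduced (h : List (Event (CMethod V E) I)) (T : I) :
    List (Event (CMethod V E) I) :=
  h.filter fun e => decide (InducedMethod h T e.method)

/-- `h` is locally linearizable wrt `S`: every thread-induced history is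
linearizable wrt `S`, and the thread-induced histories decompose `h`. -/
def LocallyLinearizable (S : Set (List (CMethod V E)))
    (h : List (Event (CMethod V E) I)) : Prop :=
  (∀ T : I, Linearizable S (threadInduced h T)) ∧
  (∀ m : CMethod V E, Appears h m → ∃ T : I, InducedMethod h T m)

/-- The pool sequential specification `S_P`. -/
def poolSpec (V : Type u) (E : Type v) : Set (List (CMethod V E)) :=
  { s | s.Nodup ∧
    (∀ x : V, CMethod.rem (Sum.inl x) ∈ s →
      CMethod.ins x ∈ s ∧
      OccursBefore s (CMethod.ins x) (CMethod.rem (Sum.inl x))) ∧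
    (∀ (e : E) (x : V),
      OccursBefore s (CMethod.ins x) (CMethod.rem (Sum.inr e)) →
      CMethod.rem (Sum.inl x) ∈ s ∧
      OccursBefore s (CMethod.rem (Sum.inl x)) (CMethod.rem (Sum.inr e))) }

/-- The queue sequential specification `S_Q` (pool axioms plus queue order). -/
def queueSpec (V : Type u) (E : Type v) : Set (List (CMethod V E)) :=
  { s | s ∈ poolSpec V E ∧
    ∀ x y : V, OccursBefore s (CMethod.ins x) (CMethod.ins y) →
      CMethod.rem (Sum.inl y) ∈ s →
      CMethod.rem (Sum.inl x) ∈ s ∧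
      OccursBefore s (CMethod.rem (Sum.inl x)) (CMethod.rem (Sum.inl y)) }

/-- The stack sequential specification `S_S` (pool axioms plus stack order). -/
def stackSpec (V : Type u) (E : Type v) : Set (List (CMethod V E)) :=
  { s | s ∈ poolSpec V E ∧
    ∀ x y : V, OccursBefore s (CMethod.ins x) (CMethod.ins y) →
      OccursBefore s (CMethod.ins y) (CMethod.rem (Sum.inl x)) →
      CMethod.rem (Sum.inl y) ∈ s ∧
      OccursBefore s (CMethod.rem (Sum.inl y)) (CMethod.rem (Sum.inl x)) }

/-- A method call's value lies in `V' ∪ Emp`. -/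
def ProjKeep (V' : Set V) : CMethod V E → Prop
  | .ins x => x ∈ V'
  | .rem (Sum.inl x) => x ∈ V'
  | .rem (Sum.inr _) => True

open Classical in
/-- The data-projection of a sequence: the subsequence of method calls whose
value lies in `V' ∪ Emp`. -/
noncomputable def dataProj (V' : Set V) (s : List (CMethod V E)) :
    List (CMethod V E) :=
  s.filter fun m => decide (ProjKeep V' m)

/-- `S` is closed under data-projection. -/
def ClosedUnderDataProjection (S : Set (List (CMethod V E))) : Prop :=
  ∀ s ∈ S, ∀ V' : Set V, dataProj V' s ∈ S

end LL

namespace LL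

theorem occursBefore_iff_sublist {α : Type*} {s : List α} {a b : α} :
    OccursBefore s a b ↔ [a, b].Sublist s := by
  constructor
  · rintro ⟨i, j, hij, rfl, rfl⟩
    have h : [i, j].Pairwise (· < ·) := by simpa using hij
    simpa using List.map_getElem_sublist h
  · intro h
    obtain ⟨f, hf⟩ := List.sublist_iff_exists_fin_orderEmbedding_get_eq.1 h
    exact ⟨f ⟨0, by simp⟩, f ⟨1, by simp⟩, f.lt_iff_lt.2 (by simp),
      (hf ⟨0, by simp⟩).symm, (hf ⟨1, by simp⟩).symm⟩

theorem mem_dataProj {V E : Type*} {V' : Set V} {s : List (CMethod V E)} {m : CMethod V E} :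
    m ∈ dataProj V' s ↔ m ∈ s ∧ ProjKeep V' m := by
  simp [dataProj]

theorem occursBefore_dataProj {V E : Type*} {V' : Set V} {s : List (CMethod V E)}
    {a b : CMethod V E} :
    OccursBefore (dataProj V' s) a b ↔ OccursBefore s a b ∧ ProjKeep V' a ∧ ProjKeep V' b := by
  classical
  simp only [occursBefore_iff_sublist]
  constructor
  · intro h
    exact ⟨h.trans List.filter_sublist, (mem_dataProj.1 (h.subset (by simp))).2,
      (mem_dataProj.1 (h.subset (by simp))).2⟩
  · rintro ⟨h, ha, hb⟩
    simpa [dataProj, ha, hb] using h.filter fun m => decide (ProjKeep V' m)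

theorem poolSpec_closedUnderDataProjection (V E : Type*) :
    ClosedUnderDataProjection (poolSpec V E) := by
  rintro s ⟨hnodup, hrem, hemp⟩ V'
  refine ⟨hnodup.filter _, fun x hx => ?_, fun e x h => ?_⟩
  · obtain ⟨hxs, hxV⟩ := mem_dataProj.1 hx
    obtain ⟨hins, hlt⟩ := hrem x hxs
    exact ⟨mem_dataProj.2 ⟨hins, hxV⟩, occursBefore_dataProj.2 ⟨hlt, hxV, hxV⟩⟩
  · obtain ⟨hlt, hxV, he⟩ := occursBefore_dataProj.1 h
    obtain ⟨hmem, hlt'⟩ := hemp e x hlt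
    exact ⟨mem_dataProj.2 ⟨hmem, hxV⟩, occursBefore_dataProj.2 ⟨hlt', hxV, he⟩⟩

/-- The stack sequential specification is closed under data-projection. -/
theorem stackSpec_closedUnderDataProjection (V E : Type*) :
    ClosedUnderDataProjection (stackSpec V E) := by
  rintro s ⟨hpool, hstack⟩ V'
  refine ⟨poolSpec_closedUnderDataProjection V E s hpool V', fun x y hxy hyx => ?_⟩
  obtain ⟨hlt, hxV, hyV⟩ := occursBefore_dataProj.1 hxy
  obtain ⟨hmem, hlt'⟩ := hstack x y hlt (occursBefore_dataProj.1 hyx).1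
  exact ⟨mem_dataProj.2 ⟨hmem, hyV⟩, occursBefore_dataProj.2 ⟨hlt', hyV, hxV⟩⟩

end LL
end

section
/- Every sane pool history is quiescently consistent: let h be a concurrent history over Σ_P satisfying (1) for every x ∈ V at most one method call rem(x) appears in h; (2) for every x ∈ V, if rem(x) appears in h then ins(x) appears in h and it is not the case that rem(x) <_h ins(x); (3) for every x ∈ V and e ∈ Emp, if rem(e) <_h rem(x) then it is not the case that ins(x) <_h rem(e), and if ins(x) <_h rem(e) then rem(x) appears in h and it is not the case that rem(e) <_h rem(x). Then h is quiescently consistent with respect to S_P. -/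
namespace LL

open Classical in
/-- The responses missing from `h`: one for each pending invocation. -/
noncomputable def pendingResponses {σ I : Type*} (h : List (Event σ I)) : List (Event σ I) :=
  (h.filter fun e => decide (e.isInv = true ∧ Event.res e.method e.thread ∉ h)).map
    fun e => Event.res e.method e.thread

theorem mem_pendingResponses {σ I : Type*} {h : List (Event σ I)} {e : Event σ I} :
    e ∈ pendingResponses h ↔ ∃ m k, e = Event.res m k ∧ PendingCall h m k := by
  simp only [pendingResponses, List.mem_map, List.mem_filter, decide_eq_true_eq]
  constructor
  · rintro ⟨e', ⟨hmem, hinv, hres⟩, rfl⟩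
    cases e' with
    | inv m k => exact ⟨m, k, rfl, hmem, hres⟩
    | res m k => simp [Event.isInv] at hinv
  · rintro ⟨m, k, rfl, hinv, hres⟩
    exact ⟨Event.inv m k, ⟨hinv, rfl, hres⟩, rfl⟩

theorem nodup_pendingResponses {σ I : Type*} {h : List (Event σ I)} (hn : h.Nodup) :
    (pendingResponses h).Nodup := by
  refine List.Nodup.map_on ?_ (hn.filter _)
  intro a ha b hb hab
  have ha' := (List.mem_filter.1 ha).2
  have hb' := (List.mem_filter.1 hb).2
  cases a <;> cases b <;> simp_all [Event.isInv, Event.method, Event.thread]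

theorem inv_not_mem_pendingResponses {σ I : Type*} {h : List (Event σ I)} (m : σ) (k : I) :
    Event.inv m k ∉ pendingResponses h := by
  intro hm
  obtain ⟨m', k', he, -⟩ := mem_pendingResponses.1 hm
  cases he

theorem getElem?_inv_of_append_pendingResponses {σ I : Type*} {h : List (Event σ I)}
    {i : ℕ} {m : σ} {k : I} (hi : (h ++ pendingResponses h)[i]? = some (Event.inv m k)) :
    h[i]? = some (Event.inv m k) := by
  rw [List.getElem?_append] at hi
  split_ifs at hi with hlt
  · exact hi
  · exact absurd (List.mem_of_getElem? hi) (inv_not_mem_pendingResponses m k)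

theorem mem_threadEvents {σ I : Type*} {h : List (Event σ I)} {k : I} {e : Event σ I} :
    e ∈ threadEvents h k ↔ e ∈ h ∧ e.thread = k := by
  simp [threadEvents]

theorem IsHistory.eq_of_pending {σ I : Type*} {h : List (Event σ I)} (hh : IsHistory h)
    {m m' : σ} {k : I} {i : ℕ} (hi : (threadEvents h k)[i]? = some (Event.inv m k))
    (hlast : (threadEvents h k).length ≤ i + 1) (hp : PendingCall h m' k) : m' = m := by
  have hmem : Event.inv m' k ∈ threadEvents h k := mem_threadEvents.2 ⟨hp.1, rfl⟩
  obtain ⟨j, hj⟩ := List.mem_iff_getElem?.1 hmem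
  obtain ⟨hjl, -⟩ := List.getElem?_eq_some_iff.1 hj
  by_cases hlt : j + 1 < (threadEvents h k).length
  · have hnext := hh.threadSeq k j m' hj _ (List.getElem?_eq_getElem hlt)
    have hres : Event.res m' k ∈ threadEvents h k := hnext ▸ List.getElem_mem hlt
    exact absurd (mem_threadEvents.1 hres).1 hp.2
  · obtain ⟨hil, -⟩ := List.getElem?_eq_some_iff.1 hi
    obtain rfl : i = j := by omega
    rw [hi] at hj
    cases hj
    rfl

theorem IsHistory.append_pendingResponses {σ I : Type*} {h : List (Event σ I)}
    (hh : IsHistory h) : IsHistory (h ++ pendingResponses h) where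
  nodup := by
    refine List.nodup_append.2 ⟨hh.nodup, nodup_pendingResponses hh.nodup, ?_⟩
    rintro a ha b hb rfl
    obtain ⟨m, k, rfl, hp⟩ := mem_pendingResponses.1 hb
    exact hp.2 ha
  invUnique := by
    intro i j m k k' hi hj
    have hi' : h[(i : ℕ)]? = some (Event.inv m k) :=
      getElem?_inv_of_append_pendingResponses (List.getElem?_eq_some_iff.2 ⟨i.2, hi⟩)
    have hj' : h[(j : ℕ)]? = some (Event.inv m k') :=
      getElem?_inv_of_append_pendingResponses (List.getElem?_eq_some_iff.2 ⟨j.2, hj⟩)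
    obtain ⟨hil, hi''⟩ := List.getElem?_eq_some_iff.1 hi'
    obtain ⟨hjl, hj''⟩ := List.getElem?_eq_some_iff.1 hj'
    have := hh.invUnique ⟨i, hil⟩ ⟨j, hjl⟩ m k k' hi'' hj''
    exact Fin.ext (Fin.mk.inj this)
  resMatched := by
    intro j m k hj
    have hlen : h.length ≤ (h ++ pendingResponses h).length := by simp
    by_cases hlt : (j : ℕ) < h.length
    · have hj' : h.get ⟨j, hlt⟩ = Event.res m k := by
        simpa [List.getElem_append_left hlt] using hj
      obtain ⟨i, hij, hi⟩ := hh.resMatched _ m k hj'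
      refine ⟨⟨i, i.2.trans_le hlen⟩, hij, ?_⟩
      simpa [List.getElem_append_left i.2] using hi
    · have hmem : Event.res m k ∈ pendingResponses h := by
        have hj' : (h ++ pendingResponses h)[(j : ℕ)]? = some (Event.res m k) :=
          List.getElem?_eq_some_iff.2 ⟨j.2, hj⟩
        rw [List.getElem?_append_right (not_lt.1 hlt)] at hj'
        exact List.mem_of_getElem? hj'
      obtain ⟨m', k', he, hp⟩ := mem_pendingResponses.1 hmem
      cases he
      obtain ⟨i, hi, hi'⟩ := List.mem_iff_getElem.1 hp.1
      refine ⟨⟨i, hi.trans_le hlen⟩, ?_, ?_⟩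
      · exact Fin.lt_def.2 (hi.trans_le (not_lt.1 hlt))
      · simpa [List.getElem_append_left hi] using hi'
  threadSeq := by
    intro k i m hi e he
    have happ : threadEvents (h ++ pendingResponses h) k =
        threadEvents h k ++ threadEvents (pendingResponses h) k := by
      simp [threadEvents]
    rw [happ] at hi he
    have hi' : (threadEvents h k)[i]? = some (Event.inv m k) := by
      rw [List.getElem?_append] at hi
      split_ifs at hi with hlt
      · exact hi
      · exact absurd (mem_threadEvents.1 (List.mem_of_getElem? hi)).1
          (inv_not_mem_pendingResponses m k)
    rw [List.getElem?_append] at he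
    split_ifs at he with hlt
    · exact hh.threadSeq k i m hi' e he
    · obtain ⟨hmem, hk⟩ := mem_threadEvents.1 (List.mem_of_getElem? he)
      obtain ⟨m', k', rfl, hp⟩ := mem_pendingResponses.1 hmem
      cases hk
      rw [hh.eq_of_pending hi' (not_lt.1 hlt) hp]
      rfl

theorem IsHistory.isCompletionOf_append_pendingResponses {σ I : Type*} {h : List (Event σ I)}
    (hh : IsHistory h) : IsCompletionOf (h ++ pendingResponses h) h := by
  refine ⟨hh.append_pendingResponses, ?_, h, pendingResponses h, List.Sublist.refl h,
    fun e he hne => absurd he hne, fun e he => mem_pendingResponses.1 he, rfl⟩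
  intro m k hinv
  have hinv' : Event.inv m k ∈ h :=
    (List.mem_append.1 hinv).resolve_right (inv_not_mem_pendingResponses m k)
  by_cases hres : Event.res m k ∈ h
  · exact List.mem_append_left _ hres
  · exact List.mem_append_right _ (mem_pendingResponses.2 ⟨m, k, rfl, hinv', hres⟩)

theorem Appears.of_append_pendingResponses {σ I : Type*} {h : List (Event σ I)} {m : σ}
    (ha : Appears (h ++ pendingResponses h) m) : Appears h m := by
  obtain ⟨k, hk⟩ := ha
  exact ⟨k, (List.mem_append.1 hk).resolve_right (inv_not_mem_pendingResponses m k)⟩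

theorem Appears.append {σ I : Type*} {h : List (Event σ I)} {m : σ}
    (ha : Appears h m) (r : List (Event σ I)) : Appears (h ++ r) m := by
  obtain ⟨k, hk⟩ := ha
  exact ⟨k, List.mem_append_left _ hk⟩

theorem Precedes.of_append_pendingResponses {σ I : Type*} {h : List (Event σ I)} {m n : σ}
    (hp : Precedes (h ++ pendingResponses h) m n) : Precedes h m n := by
  obtain ⟨i, j, k, k', hij, hi, hj⟩ := hp
  have hj' : h[(j : ℕ)]? = some (Event.inv n k') :=
    getElem?_inv_of_append_pendingResponses (List.getElem?_eq_some_iff.2 ⟨j.2, hj⟩)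
  obtain ⟨hjl, hj''⟩ := List.getElem?_eq_some_iff.1 hj'
  have hil : (i : ℕ) < h.length := lt_trans (Fin.lt_def.1 hij) hjl
  refine ⟨⟨i, hil⟩, ⟨j, hjl⟩, k, k', hij, ?_, hj''⟩
  simpa [List.getElem_append_left hil] using hi

theorem mem_methodList {σ I : Type*} {h : List (Event σ I)} {m : σ} :
    m ∈ methodList h ↔ Appears h m := by
  simp only [methodList, List.mem_map, List.mem_filter, Appears]
  constructor
  · rintro ⟨e, ⟨he, hinv⟩, rfl⟩
    cases e with
    | inv m k => exact ⟨k, he⟩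
    | res m k => simp [Event.isInv] at hinv
  · rintro ⟨k, hk⟩
    exact ⟨_, ⟨hk, rfl⟩, rfl⟩

theorem IsHistory.nodup_methodList {σ I : Type*} {h : List (Event σ I)} (hh : IsHistory h) :
    (methodList h).Nodup := by
  refine List.Nodup.map_on ?_ (hh.nodup.filter _)
  intro a ha b hb hab
  obtain ⟨ha, ha'⟩ := List.mem_filter.1 ha
  obtain ⟨hb, hb'⟩ := List.mem_filter.1 hb
  obtain ⟨i, hi⟩ := List.mem_iff_get.1 ha
  obtain ⟨j, hj⟩ := List.mem_iff_get.1 hb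
  cases a with
  | res m k => simp [Event.isInv] at ha'
  | inv m k =>
    cases b with
    | res m k => simp [Event.isInv] at hb'
    | inv m' k' =>
      obtain rfl : m = m' := hab
      rw [← hi, ← hj, hh.invUnique i j m k k' hi hj]

open Classical in
/-- Method calls can be numbered by the last quiescent state before their invocation; this
numbering grows across quiescent states, and strictly smaller numbers imply precedence. -/
theorem IsHistory.exists_quiescentBlock {σ I : Type*} {h : List (Event σ I)}
    (hh : IsHistory h) : ∃ b : σ → ℕ,
      (∀ (m n : σ) (p : ℕ), QuiescentAt h p →
        (∃ (i : Fin h.length) (k : I), (i : ℕ) < p ∧ h.get i = Event.res m k) →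
        (∃ (j : Fin h.length) (k : I), p ≤ (j : ℕ) ∧ h.get j = Event.inv n k) → b m < b n) ∧
      (∀ m n : σ, Appears h m → Appears h n → b m < b n → Precedes h m n) := by
  have hpos : ∀ m : σ, ∃ q : ℕ, ∀ (i : Fin h.length) (k : I),
      h.get i = Event.inv m k → (i : ℕ) = q := by
    intro m
    by_cases hm : ∃ (i : Fin h.length) (k : I), h.get i = Event.inv m k
    · obtain ⟨i, k, hi⟩ := hm
      exact ⟨i, fun j k' hj => congrArg Fin.val (hh.invUnique j i m k' k hj hi)⟩
    · exact ⟨0, fun i k hi => absurd ⟨i, k, hi⟩ hm⟩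
  choose q hq using hpos
  refine ⟨fun m => Nat.findGreatest (QuiescentAt h) (q m), ?_, ?_⟩
  · rintro m n p hp ⟨i, k, hip, hi⟩ ⟨j, k', hpj, hj⟩
    obtain ⟨i', hi'i, hi'⟩ := hh.resMatched i m k hi
    have hqm := hq m i' k hi'
    rw [hq n j k' hj] at hpj
    calc Nat.findGreatest (QuiescentAt h) (q m) ≤ q m := Nat.findGreatest_le _
      _ < p := by have := Fin.lt_def.1 hi'i; omega
      _ ≤ Nat.findGreatest (QuiescentAt h) (q n) := Nat.le_findGreatest hpj hp
  · rintro m n ⟨k, hm⟩ ⟨k', hn⟩ hlt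
    obtain ⟨i, hi⟩ := List.mem_iff_get.1 hm
    obtain ⟨j, hj⟩ := List.mem_iff_get.1 hn
    have hquiet : QuiescentAt h (Nat.findGreatest (QuiescentAt h) (q n)) :=
      Nat.findGreatest_of_ne_zero rfl (by dsimp only at hlt; omega)
    have hmq : (i : ℕ) < Nat.findGreatest (QuiescentAt h) (q n) := by
      by_contra hge
      rw [hq m i k hi] at hge
      exact absurd (Nat.le_findGreatest (not_lt.1 hge) hquiet) (not_le.2 hlt)
    obtain ⟨l, hl, hl'⟩ := hquiet i m k hmq hi
    refine ⟨l, j, k, k', Fin.lt_def.2 ?_, hl', hj⟩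
    rw [hq n j k' hj]
    exact hl.trans_le (Nat.findGreatest_le _)

theorem exists_perm_monotone_rank {α : Type*} (l : List α) (rank : α → ℕ) :
    ∃ s : List α, s.Perm l ∧
      (∀ a b, OccursBefore s a b → rank a ≤ rank b) ∧
      (∀ a ∈ l, ∀ b ∈ l, rank a < rank b → OccursBefore s a b) := by
  refine ⟨l.mergeSort (fun a b => decide (rank a ≤ rank b)), List.mergeSort_perm _ _, ?_⟩
  have hs : (l.mergeSort (fun a b => decide (rank a ≤ rank b))).Pairwise
      (fun a b => rank a ≤ rank b) := by
    have := List.pairwise_mergeSort (le := fun a b => decide (rank a ≤ rank b))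
      (fun a b c hab hbc => by simp only [decide_eq_true_eq] at *; omega)
      (fun a b => by simp only [Bool.or_eq_true, decide_eq_true_eq]; omega) l
    simpa using this
  have hle : ∀ a b, OccursBefore (l.mergeSort fun a b => decide (rank a ≤ rank b)) a b →
      rank a ≤ rank b := by
    rintro a b ⟨i, j, hij, rfl, rfl⟩
    exact List.pairwise_iff_get.1 hs i j hij
  refine ⟨hle, fun a ha b hb hab => ?_⟩
  obtain ⟨i, hi⟩ := List.mem_iff_get.1 (List.mem_mergeSort.2 ha)
  obtain ⟨j, hj⟩ := List.mem_iff_get.1 (List.mem_mergeSort.2 hb)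
  refine ⟨i, j, ?_, hi, hj⟩
  rcases lt_trichotomy i j with hij | hij | hij
  · exact hij
  · subst hij
    rw [hi] at hj
    subst hj
    exact absurd hab (lt_irrefl _)
  · exact absurd (hle b a ⟨j, i, hij, hj, hi⟩) (not_le.2 hab)

/-- Rank of a pool method call in block order `b`. Within a block come first the removals of
values inserted in earlier blocks, then the empty removals, then the insertions, and finally
the remaining removals. -/
def poolRank {V E : Type*} (b : CMethod V E → ℕ) : CMethod V E → ℕ
  | .ins x => 4 * b (.ins x) + 2
  | .rem (Sum.inl x) =>
      4 * b (.rem (Sum.inl x)) + if b (.ins x) < b (.rem (Sum.inl x)) then 0 else 3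
  | .rem (Sum.inr e) => 4 * b (.rem (Sum.inr e)) + 1

theorem poolRank_lt {V E : Type*} {b : CMethod V E → ℕ} {m n : CMethod V E} (hmn : b m < b n) :
    poolRank b m < poolRank b n := by
  have hlow : ∀ n, 4 * b n ≤ poolRank b n := by
    rintro (x | x | e) <;> simp [poolRank]
  have hup : ∀ m, poolRank b m < 4 * b m + 4 := by
    rintro (x | x | e) <;> simp only [poolRank] <;> (try split_ifs) <;> omega
  have := hlow n
  have := hup m
  omega

/-- Every sane pool history (no duplicated values, no out-of-thin-air values,
no lost values) is quiescently consistent wrt the pool specification. -/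
theorem sane_pool_history_quiescentlyConsistent
    (V E I : Type*) (h : List (Event (CMethod V E) I)) (hh : IsHistory h)
    (h1 : ∀ (x : V) (i j : Fin h.length) (k k' : I),
        h.get i = Event.inv (CMethod.rem (Sum.inl x)) k →
        h.get j = Event.inv (CMethod.rem (Sum.inl x)) k' → i = j)
    (h2 : ∀ x : V, Appears h (CMethod.rem (Sum.inl x)) →
        Appears h (CMethod.ins x) ∧
        ¬ Precedes h (CMethod.rem (Sum.inl x)) (CMethod.ins x))
    (h3 : ∀ (x : V) (e : E),
        (Precedes h (CMethod.rem (Sum.inr e)) (CMethod.rem (Sum.inl x)) →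
          ¬ Precedes h (CMethod.ins x) (CMethod.rem (Sum.inr e))) ∧
        (Precedes h (CMethod.ins x) (CMethod.rem (Sum.inr e)) →
          Appears h (CMethod.rem (Sum.inl x)) ∧
          ¬ Precedes h (CMethod.rem (Sum.inr e)) (CMethod.rem (Sum.inl x)))) :
    QuiescentConsistent (poolSpec V E) h := by
  have hc := hh.append_pendingResponses
  obtain ⟨b, hquiet, hprec⟩ := hc.exists_quiescentBlock
  replace hprec : ∀ m n, Appears h m → Appears h n → b m < b n → Precedes h m n :=
    fun m n hm hn hlt => (hprec m n (hm.append _) (hn.append _) hlt).of_append_pendingResponses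
  obtain ⟨s, hperm, hle, hlt⟩ :=
    exists_perm_monotone_rank (methodList (h ++ pendingResponses h)) (poolRank b)
  have hmem : ∀ m, m ∈ methodList (h ++ pendingResponses h) ↔ Appears h m := fun m =>
    mem_methodList.trans ⟨Appears.of_append_pendingResponses, fun hm => hm.append _⟩
  have hmems : ∀ m, m ∈ s ↔ Appears h m := fun m => hperm.mem_iff.trans (hmem m)
  replace hlt : ∀ m n, Appears h m → Appears h n → poolRank b m < poolRank b n →
      OccursBefore s m n := fun m n hm hn => hlt m ((hmem m).2 hm) n ((hmem n).2 hn)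
  refine ⟨_, hh.isCompletionOf_append_pendingResponses, s, ⟨?_, ?_, ?_⟩, hperm, ?_⟩
  · exact hperm.nodup_iff.2 hc.nodup_methodList
  · intro x hx
    have hrem := (hmems _).1 hx
    obtain ⟨hins, hnot⟩ := h2 x hrem
    refine ⟨(hmems _).2 hins, hlt _ _ hins hrem ?_⟩
    have hge := mt (hprec _ _ hrem hins) hnot
    simp only [poolRank]
    split_ifs <;> omega
  · intro e x hocc
    have hrank := hle _ _ hocc
    obtain ⟨i, j, -, hi, hj⟩ := hocc
    have hins : Appears h (CMethod.ins x) := (hmems _).1 (hi ▸ List.get_mem s i)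
    have hemp : Appears h (CMethod.rem (Sum.inr e)) := (hmems _).1 (hj ▸ List.get_mem s j)
    simp only [poolRank] at hrank
    have hblock : b (CMethod.ins x) < b (CMethod.rem (Sum.inr e)) := by omega
    obtain ⟨hrem, hnot⟩ := (h3 x e).2 (hprec _ _ hins hemp hblock)
    refine ⟨(hmems _).2 hrem, hlt _ _ hrem hemp ?_⟩
    have hge := mt (hprec _ _ hemp hrem) hnot
    simp only [poolRank]
    split_ifs <;> omega
  · rintro m n ⟨p, hp, hm, hn⟩
    have hblock := hquiet m n p hp hm hn
    obtain ⟨i, k, -, hi⟩ := hm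
    obtain ⟨j, k', -, hj⟩ := hn
    obtain ⟨i', -, hi'⟩ := hc.resMatched i m k hi
    have hma : Appears (h ++ pendingResponses h) m := ⟨k, hi' ▸ List.get_mem _ i'⟩
    have hna : Appears (h ++ pendingResponses h) n := ⟨k', hj ▸ List.get_mem _ j⟩
    exact hlt m n hma.of_append_pendingResponses hna.of_append_pendingResponses
      (poolRank_lt hblock)

end LL
end

section
/- For queue, local linearizability is incomparable to quiescent consistency: (i) there exists a concurrent history over Σ_Q that is quiescently consistent with respect to S_Q but not locally linearizable with respect to S_Q; and (ii) there exists a concurrent history over Σ_Q that is locally linearizable with respect to S_Q but not quiescently consistent with respect to S_Q. -/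
namespace LL

section

variable {σ I V E α : Type*}

theorem not_occursBefore_nil (a b : α) : ¬ OccursBefore [] a b := by
  rintro ⟨i, -⟩
  exact i.elim0

theorem occursBefore_cons {s : List α} {a b c : α} :
    OccursBefore (c :: s) a b ↔ (c = a ∧ b ∈ s) ∨ OccursBefore s a b := by
  constructor
  · rintro ⟨i, j, hij, hi, hj⟩
    induction j using Fin.cases with
    | zero => exact absurd hij (Fin.not_lt_zero i)
    | succ j =>
      induction i using Fin.cases with
      | zero => exact Or.inl ⟨hi, hj ▸ List.get_mem s j⟩
      | succ i => exact Or.inr ⟨i, j, Fin.succ_lt_succ_iff.mp hij, hi, hj⟩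
  · rintro (⟨rfl, hb⟩ | ⟨i, j, hij, hi, hj⟩)
    · obtain ⟨j, hj⟩ := List.get_of_mem hb
      exact ⟨0, j.succ, Fin.succ_pos j, rfl, hj⟩
    · exact ⟨i.succ, j.succ, Fin.succ_lt_succ_iff.mpr hij, hi, hj⟩

theorem methodList_nil : methodList ([] : List (Event σ I)) = [] := rfl

theorem methodList_cons_inv (m : σ) (k : I) (h : List (Event σ I)) :
    methodList (Event.inv m k :: h) = m :: methodList h := rfl

theorem methodList_cons_res (m : σ) (k : I) (h : List (Event σ I)) :
    methodList (Event.res m k :: h) = methodList h := rfl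

theorem precedes_iff {h : List (Event σ I)} {m n : σ} :
    Precedes h m n ↔ ∃ k k', OccursBefore h (Event.res m k) (Event.inv n k') := by
  constructor
  · rintro ⟨i, j, k, k', hij⟩
    exact ⟨k, k', i, j, hij⟩
  · rintro ⟨k, k', i, j, hij⟩
    exact ⟨i, j, k, k', hij⟩

theorem OccursBefore.asymm_of_nodup {s : List α} (hs : s.Nodup) {a b : α}
    (hab : OccursBefore s a b) : ¬ OccursBefore s b a := by
  obtain ⟨i, j, hij, rfl, rfl⟩ := hab
  rintro ⟨i', j', hij', hi', hj'⟩
  rw [hs.get_inj_iff] at hi' hj'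
  subst hi' hj'
  exact lt_asymm hij hij'

theorem IsHistory.isCompletionOf_self {h : List (Event σ I)} (hh : IsHistory h)
    (hc : HistComplete h) : IsCompletionOf h h :=
  ⟨hh, hc, h, [], List.Sublist.refl h, fun e he he' => absurd he he', by simp, by simp⟩

theorem IsCompletionOf.eq_of_histComplete {hc h : List (Event σ I)}
    (hcomp : IsCompletionOf hc h) (hnd : h.Nodup) (hh : HistComplete h) : hc = h := by
  obtain ⟨-, -, h', r, hsub, hdel, happ, rfl⟩ := hcomp
  have hr : r = [] := List.eq_nil_iff_forall_not_mem.mpr fun e he => by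
    obtain ⟨m, k, -, hi, hr⟩ := happ e he
    exact hr (hh m k hi)
  have hsub' : h ⊆ h' := fun e he => by
    by_contra hne
    obtain ⟨m, k, -, hi, hr⟩ := hdel e he hne
    exact hr (hh m k hi)
  rw [hr, List.append_nil]
  exact hsub.eq_of_length_le (hnd.subperm hsub').length_le

theorem isHistory_nil : IsHistory ([] : List (Event σ I)) where
  nodup := List.nodup_nil
  invUnique i := i.elim0
  resMatched j := j.elim0
  threadSeq k i m hi := by simp [threadEvents] at hi

theorem isHistory_cons_inv_cons_res {h : List (Event σ I)} (hh : IsHistory h) {m : σ} {k : I}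
    (hinv : ∀ k', Event.inv m k' ∉ h) (hres : Event.res m k ∉ h) :
    IsHistory (Event.inv m k :: Event.res m k :: h) where
  nodup := by simp [hinv, hres, hh.nodup]
  invUnique i j m' l l' hi hj := by
    have aux (i : Fin h.length) (l : I) : h.get i ≠ Event.inv m l := fun hi =>
      hinv l (hi ▸ List.get_mem h i)
    induction i using Fin.cases with
    | zero =>
      induction j using Fin.cases with
      | zero => rfl
      | succ j =>
        induction j using Fin.cases with
        | zero => simp at hj
        | succ j =>
          obtain ⟨rfl, -⟩ : m = m' ∧ k = l := by simpa using hi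
          exact absurd hj (aux j l')
    | succ i =>
      induction i using Fin.cases with
      | zero => simp at hi
      | succ i =>
        induction j using Fin.cases with
        | zero =>
          obtain ⟨rfl, -⟩ : m = m' ∧ k = l' := by simpa using hj
          exact absurd hi (aux i l)
        | succ j =>
          induction j using Fin.cases with
          | zero => simp at hj
          | succ j => rw [hh.invUnique i j m' l l' hi hj]
  resMatched j m' l hj := by
    induction j using Fin.cases with
    | zero => simp at hj
    | succ j =>
      induction j using Fin.cases with
      | zero =>
        obtain ⟨rfl, rfl⟩ : m = m' ∧ k = l := by simpa using hj
        exact ⟨0, Fin.succ_pos _, rfl⟩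
      | succ j =>
        obtain ⟨i, hij, hi⟩ := hh.resMatched j m' l hj
        exact ⟨i.succ.succ, by simpa using hij, hi⟩
  threadSeq l i m' hi e he := by
    by_cases hkl : k = l
    · have heq : threadEvents (Event.inv m k :: Event.res m k :: h) l =
          Event.inv m k :: Event.res m k :: threadEvents h l := by
        simp [threadEvents, Event.thread, hkl]
      rw [heq] at hi he
      match i with
      | 0 => simp_all
      | 1 => simp at hi
      | i + 2 => exact hh.threadSeq l i m' (by simpa using hi) e (by simpa using he)
    · have heq : threadEvents (Event.inv m k :: Event.res m k :: h) l = threadEvents h l := by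
        simp [threadEvents, Event.thread, hkl]
      rw [heq] at hi he
      exact hh.threadSeq l i m' hi e he

theorem linearizable_nil {S : Set (List σ)} (hS : [] ∈ S) :
    Linearizable S ([] : List (Event σ I)) := by
  refine ⟨[], isHistory_nil.isCompletionOf_self (by simp [HistComplete]), [], hS,
    by simp [methodList_nil], fun m n hmn => ?_⟩
  obtain ⟨k, k', hk⟩ := precedes_iff.mp hmn
  exact absurd hk (not_occursBefore_nil _ _)

theorem exists_quiescentConsistent_not_locallyLinearizable
    {x z : V} (hxz : x ≠ z) {T₁ T₂ : I} (hT : T₁ ≠ T₂) :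
    ∃ h : List (Event (CMethod V E) I), IsHistory h ∧
      QuiescentConsistent (queueSpec V E) h ∧ ¬ LocallyLinearizable (queueSpec V E) h := by
  set h : List (Event (CMethod V E) I) :=
    [.inv (.ins z) T₂, .inv (.rem (.inl x)) T₁, .res (.rem (.inl x)) T₁,
      .inv (.ins x) T₁, .res (.ins x) T₁, .res (.ins z) T₂] with h_def
  have hist : IsHistory h := by
    refine ⟨?_, ?_, ?_, ?_⟩
    · simp [h_def, hxz, hxz.symm, hT, hT.symm]
    · intro i j m k k' hi hj
      fin_cases i <;> fin_cases j <;> simp_all <;> grind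
    · intro j m k hj
      fin_cases j <;> simp [h_def] at hj <;> obtain ⟨rfl, rfl⟩ := hj
      · exact ⟨⟨1, by simp [h_def]⟩, Fin.lt_def.mpr (by simp), rfl⟩
      · exact ⟨⟨3, by simp [h_def]⟩, Fin.lt_def.mpr (by simp), rfl⟩
      · exact ⟨⟨0, by simp [h_def]⟩, Fin.lt_def.mpr (by simp), rfl⟩
    · intro k i m hi e he
      by_cases h1 : T₁ = k
      · subst h1
        have heq : threadEvents h T₁ = [.inv (.rem (.inl x)) T₁, .res (.rem (.inl x)) T₁,
            .inv (.ins x) T₁, .res (.ins x) T₁] := by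
          simp [threadEvents, h_def, Event.thread, hT.symm]
        rw [heq] at hi he
        match i with
        | 0 | 1 | 2 | 3 => simp_all
        | i + 4 => simp at hi
      · by_cases h2 : T₂ = k
        · subst h2
          have heq : threadEvents h T₂ = [.inv (.ins z) T₂, .res (.ins z) T₂] := by
            simp [threadEvents, h_def, Event.thread, hT]
          rw [heq] at hi he
          match i with
          | 0 | 1 => simp_all
          | i + 2 => simp at hi
        · simp [threadEvents, h_def, Event.thread, h1, h2] at hi
  have hcomplete : HistComplete h := by
    intro m k hm
    simp [h_def] at hm ⊢
    tauto
  refine ⟨h, hist, ⟨h, hist.isCompletionOf_self hcomplete,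
    [.ins x, .rem (.inl x), .ins z], ?_, ?_, ?_⟩, ?_⟩
  · simp [queueSpec, poolSpec, occursBefore_cons, not_occursBefore_nil, hxz]
    grind
  · exact List.reverse_perm [CMethod.ins z, .rem (.inl x), .ins x]
  · rintro m n ⟨p, hp, ⟨i, k, hip, hi⟩, ⟨j, k', hpj, hj⟩⟩
    obtain ⟨l, hlp, hl⟩ := hp ⟨0, by simp [h_def]⟩ (.ins z) T₂ (Nat.zero_lt_of_lt hip) rfl
    fin_cases l <;> fin_cases j <;> simp_all <;> omega
  · rintro ⟨hlin, -⟩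
    have heq : threadInduced h T₁ = [.inv (.rem (.inl x)) T₁, .res (.rem (.inl x)) T₁,
        .inv (.ins x) T₁, .res (.ins x) T₁] := by
      simp [threadInduced, h_def, Event.method, InducedMethod, hxz.symm, hT]
    obtain ⟨hc, hcomp, s, hs, hperm, hord⟩ := hlin T₁
    rw [heq] at hcomp
    obtain rfl := hcomp.eq_of_histComplete (by simp) (by
      intro m k hm
      simp at hm ⊢
      tauto)
    have hbefore := hord (.rem (.inl x)) (.ins x)
      (precedes_iff.mpr ⟨T₁, T₁, by simp [occursBefore_cons]⟩)
    have hmem : CMethod.rem (.inl x) ∈ s := hperm.mem_iff.mpr (by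
      simp [methodList_nil, methodList_cons_inv, methodList_cons_res])
    exact hbefore.asymm_of_nodup hs.1.1 (hs.1.2.1 x hmem).2

theorem exists_locallyLinearizable_not_quiescentConsistent
    {x z : V} (hxz : x ≠ z) {T₁ T₂ : I} (hT : T₁ ≠ T₂) :
    ∃ h : List (Event (CMethod V E) I), IsHistory h ∧
      LocallyLinearizable (queueSpec V E) h ∧ ¬ QuiescentConsistent (queueSpec V E) h := by
  set h : List (Event (CMethod V E) I) :=
    [.inv (.ins x) T₁, .res (.ins x) T₁, .inv (.ins z) T₂, .res (.ins z) T₂,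
      .inv (.rem (.inl z)) T₂, .res (.rem (.inl z)) T₂] with h_def
  have hist : IsHistory h := by
    refine isHistory_cons_inv_cons_res (isHistory_cons_inv_cons_res
      (isHistory_cons_inv_cons_res isHistory_nil ?_ ?_) ?_ ?_) ?_ ?_ <;> simp [hxz]
  have hcomplete : HistComplete h := by
    intro m k hm
    simp [h_def] at hm ⊢
    tauto
  refine ⟨h, hist, ⟨fun T => ?_, ?_⟩, ?_⟩
  · by_cases h1 : T = T₁
    · subst h1
      have heq : threadInduced h T = [.inv (.ins x) T, .res (.ins x) T] := by
        simp [threadInduced, h_def, Event.method, InducedMethod, hxz.symm, hT]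
      rw [heq]
      refine ⟨_, IsHistory.isCompletionOf_self
        (isHistory_cons_inv_cons_res isHistory_nil (by simp) (by simp))
        (by simp [HistComplete]), [.ins x], ?_, ?_, ?_⟩
      · simp [queueSpec, poolSpec, occursBefore_cons, not_occursBefore_nil]
      · simp [methodList_nil, methodList_cons_inv, methodList_cons_res]
      · intro m n hmn
        simp [precedes_iff, occursBefore_cons, not_occursBefore_nil] at hmn
    · by_cases h2 : T = T₂
      · subst h2
        have heq : threadInduced h T = [.inv (.ins z) T, .res (.ins z) T,
            .inv (.rem (.inl z)) T, .res (.rem (.inl z)) T] := by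
          simp [threadInduced, h_def, Event.method, InducedMethod, hxz, hT.symm]
        rw [heq]
        refine ⟨_, IsHistory.isCompletionOf_self
          (isHistory_cons_inv_cons_res (isHistory_cons_inv_cons_res isHistory_nil
            (by simp) (by simp)) (by simp) (by simp)) ?_, [.ins z, .rem (.inl z)], ?_, ?_, ?_⟩
        · intro m k hm
          simp at hm ⊢
          tauto
        · simp [queueSpec, poolSpec, occursBefore_cons, not_occursBefore_nil]
        · simp [methodList_nil, methodList_cons_inv, methodList_cons_res]
        · intro m n hmn
          simp [precedes_iff, occursBefore_cons, not_occursBefore_nil] at hmn ⊢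
          grind
      · have heq : threadInduced h T = [] := by
          simp [threadInduced, h_def, Event.method, InducedMethod, h1, h2]
        rw [heq]
        exact linearizable_nil (by simp [queueSpec, poolSpec, not_occursBefore_nil])
  · rintro m ⟨k, hk⟩
    simp [h_def] at hk
    rcases hk with ⟨rfl, rfl⟩ | ⟨rfl, rfl⟩ | ⟨rfl, rfl⟩ <;>
      exact ⟨k, by simp [InducedMethod, h_def]⟩
  · rintro ⟨hc, hcomp, s, hs, hperm, hord⟩
    obtain rfl := hcomp.eq_of_histComplete hist.nodup hcomplete
    have hbefore := hord (.ins x) (.ins z) ⟨2, ?_,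
      ⟨⟨1, by simp [h_def]⟩, T₁, by simp, rfl⟩, ⟨⟨2, by simp [h_def]⟩, T₂, by simp, rfl⟩⟩
    · have hmem : CMethod.rem (.inl z) ∈ s := hperm.mem_iff.mpr (by
        simp [h_def, methodList_nil, methodList_cons_inv, methodList_cons_res])
      have hmem' := hperm.mem_iff.mp (hs.2 x z hbefore hmem).1
      simp [h_def, methodList_nil, methodList_cons_inv, methodList_cons_res, hxz] at hmem'
    · intro i m k hi him
      refine ⟨⟨1, by simp [h_def]⟩, by simp, ?_⟩
      fin_cases i <;> simp_all

end

/-- For queue, local linearizability is incomparable to quiescent consistency. -/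
theorem queue_locallyLinearizable_incomparable_quiescentConsistent
    (V E I : Type*) (x y z : V) (hxy : x ≠ y) (hxz : x ≠ z) (hyz : y ≠ z)
    (T₁ T₂ : I) (hT : T₁ ≠ T₂) :
    (∃ h : List (Event (CMethod V E) I), IsHistory h ∧
        QuiescentConsistent (queueSpec V E) h ∧
        ¬ LocallyLinearizable (queueSpec V E) h) ∧
    (∃ h : List (Event (CMethod V E) I), IsHistory h ∧
        LocallyLinearizable (queueSpec V E) h ∧
        ¬ QuiescentConsistent (queueSpec V E) h) :=
  ⟨exists_quiescentConsistent_not_locallyLinearizable hxz hT,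
    exists_locallyLinearizable_not_quiescentConsistent hxz hT⟩

end LL
end
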